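/- Suppose n ≠ 0, χ is a primitive Dirichlet character modulo N_β, let g = gcd(N_β, N_β(γ,β)), and let p be a prime dividing g such that N_β is a power of p. Let N_γ be the order of γ + ℤ^m in L'/ℤ^m and set w_p = 1 + 2·ν_p(2N_βN_γn) (note 2N_βN_γn is a nonzero integer). Then G_{γ,n}(p^α; β, χ) = 0 for all integers α > w_p. -/

import Mathlib

open Finset Matrix

namespace EisensteinWeil

variable {m : ℕ}

/-- The bilinear form `(x,y) = xᵀ S y` on `ℚ^m`. -/
def bil (S : Matrix (Fin m) (Fin m) ℤ) (x y : Fin m → ℚ) : ℚ :=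
  x ⬝ᵥ (S.map (Int.cast : ℤ → ℚ)).mulVec y

/-- The quadratic form `Q(x) = (x,x)/2`. -/
def Qf (S : Matrix (Fin m) (Fin m) ℤ) (x : Fin m → ℚ) : ℚ := bil S x x / 2

/-- Membership in the dual lattice `L' = S⁻¹ℤ^m`: `x ∈ L'` iff `(x,r) ∈ ℤ` for all `r ∈ ℤ^m`. -/
def memDual (S : Matrix (Fin m) (Fin m) ℤ) (γ : Fin m → ℚ) : Prop :=
  ∀ r : Fin m → ℤ, ∃ z : ℤ, bil S γ (fun i => (r i : ℚ)) = z

/-- `N` is the order of `γ + ℤ^m` in `L'/ℤ^m`, i.e. the smallest positive integer with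
`N • γ ∈ ℤ^m`. -/
def isOrderOf (γ : Fin m → ℚ) (N : ℕ) : Prop :=
  0 < N ∧ (∀ i, ∃ z : ℤ, (N : ℚ) * γ i = z) ∧
    ∀ k : ℕ, 0 < k → (∀ i, ∃ z : ℤ, (k : ℚ) * γ i = z) → N ≤ k

/-- The representation number `N_{γ,n}(a)`, counting `r ∈ (ℤ^m)/(aℤ^m)`
(represented by `r : Fin m → Fin a`) with `Q(r − γ) + n ≡ 0 (mod a)`. -/
noncomputable def repNum (S : Matrix (Fin m) (Fin m) ℤ) (γ : Fin m → ℚ) (n : ℚ) (a : ℕ) : ℕ :=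
  Nat.card {r : Fin m → Fin a //
    ∃ t : ℤ, Qf S ((fun i => ((r i : ℕ) : ℚ)) - γ) + n = (a : ℚ) * t}

/-- `e(x) = e^{2πix}`. -/
noncomputable def eQ (x : ℚ) : ℂ := Complex.exp (2 * Real.pi * Complex.I * (x : ℂ))

/-- A canonical choice of inverse of `d` modulo `c`. -/
def adInv (c d : ℕ) : ℕ := ((d : ZMod c)⁻¹).val

/-- The sum `G_{γ,n}(c; β, χ)`. -/
noncomputable def Gsum (S : Matrix (Fin m) (Fin m) ℤ) (γ : Fin m → ℚ) (n : ℚ)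
    (β : Fin m → ℚ) (Nβ : ℕ) (χ : DirichletCharacter ℂ Nβ) (c : ℕ) : ℂ :=
  ∑ ν ∈ (range Nβ).filter (fun ν => Nat.Coprime ν Nβ), χ (ν : ZMod Nβ) *
    ∑ d ∈ (range c).filter (fun d => Nat.Coprime d c),
      ∑ r ∈ Fintype.piFinset (fun _ : Fin m => range c),
        eQ (((adInv c d : ℚ) * Qf S (ν • β + fun i => (r i : ℚ))
            - bil S γ (ν • β + fun i => (r i : ℚ))
            + (d : ℚ) * (Qf S γ + n)) / c)

/-- The Gauss sum `G(χ) = ∑_{u mod N, gcd(u,N)=1} χ(u) e(u/N)`. -/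
noncomputable def gaussS (N : ℕ) (χ : DirichletCharacter ℂ N) : ℂ :=
  ∑ u ∈ (range N).filter (fun u => Nat.Coprime u N), χ (u : ZMod N) * eQ (u / N)

lemma bil_add_left (S : Matrix (Fin m) (Fin m) ℤ) (x y z : Fin m → ℚ) :
    bil S (x + y) z = bil S x z + bil S y z := by
  simp [bil, add_dotProduct]

lemma bil_add_right (S : Matrix (Fin m) (Fin m) ℤ) (x y z : Fin m → ℚ) :
    bil S x (y + z) = bil S x y + bil S x z := by
  simp [bil, mulVec_add, dotProduct_add]

lemma bil_smul_left (S : Matrix (Fin m) (Fin m) ℤ) (a : ℚ) (x y : Fin m → ℚ) :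
    bil S (a • x) y = a * bil S x y := by
  simp [bil]

lemma bil_smul_right (S : Matrix (Fin m) (Fin m) ℤ) (a : ℚ) (x y : Fin m → ℚ) :
    bil S x (a • y) = a * bil S x y := by
  simp [bil, mulVec_smul]

lemma bil_comm {S : Matrix (Fin m) (Fin m) ℤ} (hS : S.IsSymm) (x y : Fin m → ℚ) :
    bil S x y = bil S y x := by
  have hST : (S.map (Int.cast : ℤ → ℚ))ᵀ = S.map (Int.cast : ℤ → ℚ) := by
    rw [← Matrix.transpose_map, hS.eq]
  rw [bil, bil, dotProduct_mulVec, ← mulVec_transpose, hST, dotProduct_comm]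

lemma Qf_add {S : Matrix (Fin m) (Fin m) ℤ} (hS : S.IsSymm) (x y : Fin m → ℚ) :
    Qf S (x + y) = Qf S x + bil S x y + Qf S y := by
  simp only [Qf, bil_add_left, bil_add_right, bil_comm hS y x]
  ring

lemma Qf_smul (S : Matrix (Fin m) (Fin m) ℤ) (a : ℚ) (x : Fin m → ℚ) :
    Qf S (a • x) = a ^ 2 * Qf S x := by
  simp only [Qf, bil_smul_left, bil_smul_right]
  ring

/-- An integral symmetric bilinear form with even diagonal takes even values on the diagonal. -/
lemma two_dvd_dotProduct_mulVec {S : Matrix (Fin m) (Fin m) ℤ} (hS : S.IsSymm)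
    (hSeven : ∀ i, 2 ∣ S i i) (r : Fin m → ℤ) : 2 ∣ r ⬝ᵥ S.mulVec r := by
  refine (ZMod.intCast_zmod_eq_zero_iff_dvd _ 2).mp ?_
  have h2 : ∀ x : ZMod 2, x + x = 0 := by decide
  simp only [dotProduct, mulVec, Finset.mul_sum, Int.cast_sum]
  rw [← Finset.sum_product']
  refine Finset.sum_involution (fun x _ => x.swap) ?_ ?_ ?_ ?_
  · rintro ⟨i, j⟩ -
    have hij : r j * (S j i * r i) = r i * (S i j * r j) := by
      rw [hS.apply i j]; ring
    simp only [Prod.swap, hij, h2]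
  · rintro ⟨i, j⟩ - hne heq
    obtain rfl : j = i := congrArg Prod.fst heq
    refine hne ((ZMod.intCast_zmod_eq_zero_iff_dvd _ 2).mpr ?_)
    exact Dvd.dvd.mul_left (Dvd.dvd.mul_right (hSeven j) _) _
  · simp
  · simp

lemma bil_intCast (S : Matrix (Fin m) (Fin m) ℤ) (r s : Fin m → ℤ) :
    bil S (fun i => (r i : ℚ)) (fun i => (s i : ℚ)) = (r ⬝ᵥ S.mulVec s : ℤ) := by
  simp [bil, dotProduct, mulVec]

lemma exists_Qf_intCast_eq {S : Matrix (Fin m) (Fin m) ℤ} (hS : S.IsSymm)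
    (hSeven : ∀ i, 2 ∣ S i i) (r : Fin m → ℤ) :
    ∃ z : ℤ, Qf S (fun i => (r i : ℚ)) = z := by
  obtain ⟨z, hz⟩ := two_dvd_dotProduct_mulVec hS hSeven r
  refine ⟨z, ?_⟩
  rw [Qf, bil_intCast, hz]
  push_cast
  ring

lemma exists_Qf_smul_add_eq {S : Matrix (Fin m) (Fin m) ℤ} (hS : S.IsSymm)
    (hSeven : ∀ i, 2 ∣ S i i) {β : Fin m → ℚ} (hβ : memDual S β) (hβiso : ∃ z : ℤ, Qf S β = z)
    (ν : ℤ) (r : Fin m → ℤ) :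
    ∃ z : ℤ, Qf S ((ν : ℚ) • β + fun i => (r i : ℚ)) = z := by
  obtain ⟨u, hu⟩ := hβiso
  obtain ⟨v, hv⟩ := hβ r
  obtain ⟨w, hw⟩ := exists_Qf_intCast_eq hS hSeven r
  refine ⟨ν ^ 2 * u + ν * v + w, ?_⟩
  rw [Qf_add hS, Qf_smul, bil_smul_left, hu, hv, hw]
  push_cast
  ring

lemma eQ_add (x y : ℚ) : eQ (x + y) = eQ x * eQ y := by
  rw [eQ, eQ, eQ, ← Complex.exp_add]
  push_cast
  ring_nf

lemma eQ_intCast (z : ℤ) : eQ z = 1 := by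
  rw [eQ, Complex.exp_eq_one_iff]
  exact ⟨z, by push_cast; ring⟩

lemma eQ_nat_mul (k : ℕ) (x : ℚ) : eQ (k * x) = eQ x ^ k := by
  rw [eQ, eQ, ← Complex.exp_nat_mul]
  push_cast
  ring_nf

lemma eQ_eq_one_iff (x : ℚ) : eQ x = 1 ↔ ∃ z : ℤ, x = z := by
  refine ⟨fun h => ?_, fun ⟨z, hz⟩ => hz ▸ eQ_intCast z⟩
  obtain ⟨z, hz⟩ := Complex.exp_eq_one_iff.mp h
  refine ⟨z, ?_⟩
  have h2 : (2 * Real.pi * Complex.I : ℂ) ≠ 0 := Complex.two_pi_I_ne_zero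
  have h3 : (x : ℂ) = z := mul_left_cancel₀ h2 (by rw [hz]; ring)
  exact_mod_cast h3

/-- Orthogonality of the additive characters modulo `p`. -/
lemma sum_eQ_mul_div_eq_zero {p : ℕ} (hp : p ≠ 0) {h : ℤ} (hh : ¬ (p : ℤ) ∣ h) :
    ∑ s ∈ range p, eQ ((s : ℚ) * (h / p)) = 0 := by
  have hp' : (p : ℚ) ≠ 0 := by exact_mod_cast hp
  have hne : eQ (h / p) ≠ 1 := fun h1 => by
    obtain ⟨z, hz⟩ := (eQ_eq_one_iff _).mp h1
    rw [div_eq_iff hp'] at hz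
    exact hh ⟨z, by rw [mul_comm]; exact_mod_cast hz⟩
  simp only [eQ_nat_mul]
  rw [geom_sum_eq hne, ← eQ_nat_mul, mul_div_cancel₀ _ hp', eQ_intCast, sub_self, zero_div]

lemma sum_comp_of_injOn {ι : Type*} (s : Finset ι) (g : ι → ι)
    (hg : ∀ x ∈ s, g x ∈ s) (hinj : Set.InjOn g s) (f : ι → ℂ) :
    ∑ x ∈ s, f (g x) = ∑ x ∈ s, f x :=
  Finset.sum_nbij g hg hinj
    (Finset.surjOn_of_injOn_of_card_le g hg hinj le_rfl) fun _ _ => rfl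

/-- Multiplication by a unit permutes the reduced residues modulo `c`. -/
lemma sum_coprime_mul_mod {c : ℕ} (hc : 0 < c) {u : ℕ} (hu : u.Coprime c) (f : ℕ → ℂ) :
    ∑ d ∈ (range c).filter (fun d => Nat.Coprime d c), f (u * d % c)
      = ∑ d ∈ (range c).filter (fun d => Nat.Coprime d c), f d := by
  refine sum_comp_of_injOn _ (fun d => u * d % c) ?_ ?_ f
  · intro d hd
    rw [mem_filter, mem_range] at hd ⊢
    refine ⟨Nat.mod_lt _ hc, ?_⟩
    rw [Nat.Coprime, (Nat.mod_modEq _ _).gcd_eq]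
    exact Nat.Coprime.mul_left hu hd.2
  · intro d hd e he hde
    simp only [coe_filter, mem_range, Set.mem_ofPred_eq] at hd he
    have h : d ≡ e [MOD c] := Nat.ModEq.cancel_left_of_coprime hu.symm hde
    rwa [Nat.ModEq, Nat.mod_eq_of_lt hd.1, Nat.mod_eq_of_lt he.1] at h

/-- Affine maps with unit slope permute `(ℤ/c)^m`. -/
lemma sum_piFinset_affine {c : ℕ} (hc : 0 < c) {w : ℤ} (hw : IsCoprime w (c : ℤ))
    (y : Fin m → ℤ) (f : (Fin m → ℕ) → ℂ) :
    ∑ r ∈ Fintype.piFinset (fun _ : Fin m => range c),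
        f (fun i => ((w * r i + y i) % c).toNat)
      = ∑ r ∈ Fintype.piFinset (fun _ : Fin m => range c), f r := by
  have hc' : (0 : ℤ) < c := by exact_mod_cast hc
  refine sum_comp_of_injOn _ (fun (r : Fin m → ℕ) i => ((w * r i + y i) % c).toNat) ?_ ?_ f
  · intro r _
    rw [Fintype.mem_piFinset]
    intro i
    have h1 := Int.emod_nonneg (w * r i + y i) hc'.ne'
    have h2 := Int.emod_lt_of_pos (w * r i + y i) hc'
    rw [mem_range]
    lia
  · intro r hr s hs hrs
    simp only [mem_coe, Fintype.mem_piFinset, mem_range] at hr hs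
    funext i
    have h := congrFun hrs i
    simp only at h
    have h1 := Int.emod_nonneg (w * r i + y i) hc'.ne'
    have h2 := Int.emod_nonneg (w * s i + y i) hc'.ne'
    have h3 : w * r i + y i ≡ w * s i + y i [ZMOD c] := by
      rw [Int.ModEq]; lia
    have h4 : (c : ℤ) ∣ w * (s i - r i) := by
      have := h3.dvd
      rwa [show w * (s i - r i) = w * s i + y i - (w * r i + y i) by ring]
    have h5 : (r i : ℤ) ≡ s i [ZMOD c] := Int.modEq_iff_dvd.mpr (hw.symm.dvd_of_dvd_mul_left h4)
    rw [Int.natCast_modEq_iff, Nat.ModEq, Nat.mod_eq_of_lt (hr i), Nat.mod_eq_of_lt (hs i)] at h5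
    exact h5

lemma exists_mul_adInv_eq {c d : ℕ} (hc : 0 < c) (hd : d.Coprime c) :
    ∃ l : ℤ, (d : ℤ) * adInv c d = 1 + c * l := by
  have : NeZero c := ⟨hc.ne'⟩
  have h : (((d : ℤ) * adInv c d : ℤ) : ZMod c) = ((1 : ℤ) : ZMod c) := by
    push_cast
    rw [adInv, ZMod.natCast_zmod_val, ZMod.coe_mul_inv_eq_one d hd]
  obtain ⟨l, hl⟩ := ((ZMod.intCast_eq_intCast_iff_dvd_sub _ _ c).mp h.symm)
  exact ⟨l, by linarith⟩

/-- How the phase changes under `x ↦ w(x + d(w-1)γ)`, `d ↦ w²d`. -/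
lemma exists_phase_eq {S : Matrix (Fin m) (Fin m) ℤ} (hS : S.IsSymm)
    (hSeven : ∀ i, 2 ∣ S i i) {γ β : Fin m → ℚ} (hγ : memDual S γ)
    {n : ℚ} (hn : ∃ z : ℤ, n + Qf S γ = z)
    (hβ : memDual S β) (hβiso : ∃ z : ℤ, Qf S β = z)
    {c d a d' a' w ν l l' j : ℤ} (hda : d * a = 1 + c * l) (hda' : d' * a' = 1 + c * l')
    (hd' : d' = w ^ 2 * d + c * j)
    {g k : Fin m → ℤ} (hg : ∀ i, ((w : ℚ) - 1) * γ i = g i) (hk : ∀ i, ((w : ℚ) - 1) * β i = k i)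
    {r r' z : Fin m → ℤ} (hr' : ∀ i, r' i = w * r i + (ν * k i + d * w * g i) + c * z i) :
    ∃ q : ℤ,
      (a' : ℚ) * Qf S ((ν : ℚ) • β + fun i => (r' i : ℚ))
          - bil S γ ((ν : ℚ) • β + fun i => (r' i : ℚ)) + (d' : ℚ) * (Qf S γ + n)
        = (a : ℚ) * Qf S ((ν : ℚ) • β + fun i => (r i : ℚ))
          - bil S γ ((ν : ℚ) • β + fun i => (r i : ℚ)) + (d : ℚ) * (Qf S γ + n)
          + ((w : ℚ) ^ 2 - 1) * d * n + c * q := by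
  set x : Fin m → ℚ := (ν : ℚ) • β + fun i => (r i : ℚ) with hx
  set G : Fin m → ℚ := fun i => (g i : ℚ) with hG
  set Z : Fin m → ℚ := fun i => (z i : ℚ) with hZ
  have hGγ : G = ((w : ℚ) - 1) • γ := by
    funext i; simp [hG, ← hg i]
  have hx' : ((ν : ℚ) • β + fun i => (r' i : ℚ))
      = (w : ℚ) • (x + (d : ℚ) • G) + (c : ℚ) • Z := by
    funext i
    simp only [hx, hG, hZ, Pi.add_apply, Pi.smul_apply, smul_eq_mul, hr' i]
    push_cast
    rw [← hk i]
    ring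
  obtain ⟨u, hu⟩ := hn
  obtain ⟨X, hX⟩ := exists_Qf_smul_add_eq hS hSeven hβ hβiso ν r
  obtain ⟨QZ, hQZ⟩ := exists_Qf_intCast_eq hS hSeven z
  obtain ⟨QG, hQG⟩ := exists_Qf_intCast_eq hS hSeven g
  obtain ⟨γZ, hγZ⟩ := hγ z
  obtain ⟨βZ, hβZ⟩ := hβ z
  obtain ⟨βG, hβG⟩ := hβ g
  have hxZ : bil S x Z = (ν * βZ + r ⬝ᵥ S.mulVec z : ℤ) := by
    rw [hx, bil_add_left, bil_smul_left, hβZ, hZ, bil_intCast]; push_cast; ring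
  have hxG : bil S x G = (ν * βG + r ⬝ᵥ S.mulVec g : ℤ) := by
    rw [hx, bil_add_left, bil_smul_left, hβG, hG, bil_intCast]; push_cast; ring
  have hGZ : bil S G Z = (g ⬝ᵥ S.mulVec z : ℤ) := by rw [hG, hZ, bil_intCast]
  generalize ν * βZ + r ⬝ᵥ S.mulVec z = xZ at hxZ
  generalize ν * βG + r ⬝ᵥ S.mulVec g = xG at hxG
  generalize g ⬝ᵥ S.mulVec z = GZ at hGZ
  have hxG' : ((w : ℚ) - 1) * bil S γ x = xG := by
    rw [← hxG, hGγ, bil_smul_right, bil_comm hS]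
  have hγG : bil S γ G = ((w : ℚ) - 1) * (2 * Qf S γ) := by
    rw [hGγ, bil_smul_right, Qf]; ring
  have hQG' : ((w : ℚ) - 1) ^ 2 * Qf S γ = QG := by
    rw [← hQG, ← hG, hGγ, Qf_smul]
  have hw : a' * w ^ 2 = a + c * (a * l' - a' * w ^ 2 * l - a * a' * j) := by
    linear_combination a * hda' - a' * w ^ 2 * hda - a * a' * hd'
  set e : ℤ := a * l' - a' * w ^ 2 * l - a * a' * j
  have hwQ : (a' : ℚ) * w ^ 2 = a + c * e := by exact_mod_cast hw
  have hdaQ : (d : ℚ) * a = 1 + c * l := by exact_mod_cast hda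
  have hdQ : (d' : ℚ) = w ^ 2 * d + c * j := by exact_mod_cast hd'
  refine ⟨e * (X + d * xG + d ^ 2 * QG) + a' * (w * (xZ + d * GZ) + c * QZ)
    + l * (xG + d * QG) - γZ + j * u, ?_⟩
  rw [← hx] at hX
  rw [← hZ] at hQZ hγZ
  rw [← hG] at hQG
  rw [hx']
  simp only [Qf_add hS, Qf_smul, bil_add_left, bil_add_right, bil_smul_left, bil_smul_right,
    hxZ, hxG, hGZ, hγZ, hγG, hX, hQZ, hQG]
  push_cast
  linear_combination ((X : ℚ) + d * xG + d ^ 2 * QG) * hwQ + (xG + d * QG : ℚ) * hdaQ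
    + (Qf S γ + n) * hdQ - hxG' - (d : ℚ) * hQG' + c * (j : ℚ) * hu

/-- The inner sums of `Gsum` are invariant under twisting by `d ↦ e((w²-1)dn/c)`. -/
lemma sum_phase_eq_sum_phase_mul {S : Matrix (Fin m) (Fin m) ℤ} (hS : S.IsSymm)
    (hSeven : ∀ i, 2 ∣ S i i) {γ β : Fin m → ℚ} (hγ : memDual S γ)
    {n : ℚ} (hn : ∃ z : ℤ, n + Qf S γ = z)
    (hβ : memDual S β) (hβiso : ∃ z : ℤ, Qf S β = z) {c w : ℕ} (hc : 0 < c) (hw : w.Coprime c)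
    {g k : Fin m → ℤ} (hg : ∀ i, ((w : ℚ) - 1) * γ i = g i) (hk : ∀ i, ((w : ℚ) - 1) * β i = k i)
    (ν : ℕ) :
    ∑ d ∈ (range c).filter (fun d => Nat.Coprime d c),
      ∑ r ∈ Fintype.piFinset (fun _ : Fin m => range c),
        eQ (((adInv c d : ℚ) * Qf S (ν • β + fun i => (r i : ℚ))
            - bil S γ (ν • β + fun i => (r i : ℚ))
            + (d : ℚ) * (Qf S γ + n)) / c)
    = ∑ d ∈ (range c).filter (fun d => Nat.Coprime d c),
      ∑ r ∈ Fintype.piFinset (fun _ : Fin m => range c),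
        eQ (((adInv c d : ℚ) * Qf S (ν • β + fun i => (r i : ℚ))
            - bil S γ (ν • β + fun i => (r i : ℚ))
            + (d : ℚ) * (Qf S γ + n)) / c) * eQ (((w : ℚ) ^ 2 - 1) * d * n / c) := by
  have hw2 : (w ^ 2).Coprime c := hw.pow_left 2
  have hcQ : (c : ℚ) ≠ 0 := by exact_mod_cast hc.ne'
  have hcZ : (c : ℤ) ≠ 0 := by exact_mod_cast hc.ne'
  rw [← sum_coprime_mul_mod hc hw2]
  refine Finset.sum_congr rfl fun d hd => ?_
  have hdc : d.Coprime c := (mem_filter.mp hd).2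
  have hdc' : (w ^ 2 * d % c).Coprime c := by
    rw [Nat.Coprime, (Nat.mod_modEq _ _).gcd_eq]
    exact hw2.mul_left hdc
  obtain ⟨l, hl⟩ := exists_mul_adInv_eq hc hdc
  obtain ⟨l', hl'⟩ := exists_mul_adInv_eq hc hdc'
  rw [← sum_piFinset_affine hc (Nat.isCoprime_iff_coprime.mpr hw)
    (fun i => ν * k i + d * w * g i)]
  refine Finset.sum_congr rfl fun r _ => ?_
  have hj : ((w ^ 2 * d % c : ℕ) : ℤ) = (w : ℤ) ^ 2 * d + c * (-((w : ℤ) ^ 2 * d / c)) := by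
    push_cast
    rw [Int.emod_def]
    ring
  have hr' : ∀ i, (((((w : ℤ) * r i + (ν * k i + d * w * g i)) % c).toNat : ℕ) : ℤ)
      = (w : ℤ) * r i + (ν * k i + d * w * g i)
        + c * (-(((w : ℤ) * r i + (ν * k i + d * w * g i)) / c)) := fun i => by
    rw [Int.toNat_of_nonneg (Int.emod_nonneg _ hcZ), Int.emod_def]
    ring
  obtain ⟨q, hq⟩ := exists_phase_eq hS hSeven hγ hn hβ hβiso (w := w) (ν := ν) hl hl' hj
    (by exact_mod_cast hg) (by exact_mod_cast hk) (r := fun i => r i) hr'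
  simp only [Int.cast_natCast, Nat.cast_smul_eq_nsmul] at hq
  rw [hq, ← eQ_add, ← mul_one (eQ (_ + _)), ← eQ_intCast q, ← eQ_add]
  congr 1
  field_simp

lemma exists_scaling {p : ℕ} (hp : p.Prime) {n : ℚ} {N M v : ℕ} (hM : M ≠ 0)
    (hN : N = p ^ v) (hv : v ≠ 0) {t : ℤ} (ht0 : t ≠ 0) (ht : (t : ℚ) = 2 * N * M * n)
    {α : ℕ} (hα : 1 + 2 * padicValInt p t < α) :
    ∃ (K : ℕ) (h : ℤ), p ∣ K ∧ N ∣ K ∧ M ∣ K ∧ ¬ (p : ℤ) ∣ h ∧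
      4 * (K : ℚ) * n * p = h * (p : ℚ) ^ α := by
  have := Fact.mk hp
  have h2t : 2 * t ≠ 0 := mul_ne_zero two_ne_zero ht0
  obtain ⟨e, M', hM', rfl⟩ := Nat.exists_eq_pow_mul_and_not_dvd hM p hp.ne_one
  have hfin : FiniteMultiplicity (p : ℤ) (2 * t) :=
    Int.finiteMultiplicity_iff.mpr ⟨by simpa using hp.ne_one, h2t⟩
  obtain ⟨h, hh, hph⟩ := hfin.exists_eq_pow_mul_and_not_dvd
  set τ := multiplicity (p : ℤ) (2 * t)
  have hτ : τ ≤ 1 + padicValInt p t := by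
    have h1 : τ ≤ padicValInt p (2 * t) :=
      ((padicValInt_dvd_iff τ (2 * t)).mp ⟨h, hh⟩).resolve_left h2t
    have h2 : padicValInt p 2 ≤ 1 := by
      have : padicValNat p 2 < 2 := lt_of_le_of_lt (padicValNat_le_nat_log _)
        (Nat.log_lt_of_lt_pow two_ne_zero (by nlinarith [hp.two_le]))
      change padicValNat p 2 ≤ 1
      lia
    rw [padicValInt.mul two_ne_zero ht0] at h1
    lia
  refine ⟨p ^ (α - 1 - τ + v + e) * M', h, ?_, ?_, ?_, hph, ?_⟩
  · exact Dvd.dvd.mul_right (dvd_pow_self p (by lia)) _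
  · rw [hN]
    exact Dvd.dvd.mul_right (pow_dvd_pow p (by lia)) _
  · exact mul_dvd_mul_right (pow_dvd_pow p (by lia)) _
  · have hpQ : (p : ℚ) ≠ 0 := by exact_mod_cast hp.ne_zero
    have hhQ : 2 * (t : ℚ) = (p : ℚ) ^ τ * h := by exact_mod_cast hh
    rw [ht, hN] at hhQ
    obtain ⟨k, rfl⟩ : ∃ k, α = k + 1 + τ := ⟨α - 1 - τ, by lia⟩
    rw [show k + 1 + τ - 1 - τ = k by lia]
    push_cast at hhQ ⊢
    simp only [pow_add, pow_one]
    linear_combination (p : ℚ) ^ k * p * hhQ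

lemma exists_sub_one_mul_eq {N : ℕ} {x : Fin m → ℚ} (hx : ∀ i, ∃ z : ℤ, (N : ℚ) * x i = z)
    {D w : ℕ} (hD : N ∣ D) (hw : w = 1 + D) :
    ∃ g : Fin m → ℤ, ∀ i, ((w : ℚ) - 1) * x i = g i := by
  choose z hz using hx
  obtain ⟨q, rfl⟩ := hD
  refine ⟨fun i => q * z i, fun i => ?_⟩
  push_cast [hw]
  rw [← hz]
  ring

/-- vanishing of `G_{γ,n}(p^α; β, χ)` for `α > w_p = 1 + 2ν_p(2N_βN_γn)`. -/
theorem Gsum_vanish_large (m : ℕ) (hm : 1 ≤ m) (S : Matrix (Fin m) (Fin m) ℤ)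
    (hSsymm : S.IsSymm) (hSeven : ∀ i, 2 ∣ S i i) (hSdet : S.det ≠ 0)
    (γ : Fin m → ℚ) (hγ : memDual S γ) (n : ℚ) (hn : ∃ z : ℤ, n + Qf S γ = z)
    (hn0 : n ≠ 0)
    (β : Fin m → ℚ) (hβ : memDual S β) (hβiso : ∃ z : ℤ, Qf S β = z)
    (Nβ : ℕ) (hNβ : isOrderOf β Nβ)
    (χ : DirichletCharacter ℂ Nβ) (hχ : χ.IsPrimitive)
    (b : ℤ) (hb : (b : ℚ) = Nβ * bil S γ β)
    (p : ℕ) (hp : p.Prime) (hpg : p ∣ Int.gcd (Nβ : ℤ) b)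
    (hppow : ∃ v : ℕ, Nβ = p ^ v)
    (Nγ : ℕ) (hNγ : isOrderOf γ Nγ)
    (t : ℤ) (ht : (t : ℚ) = 2 * Nβ * Nγ * n)
    (α : ℕ) (hα : 1 + 2 * padicValInt p t < α) :
    Gsum S γ n β Nβ χ (p ^ α) = 0 := by
  have hpN : p ∣ Nβ := by
    have := (Int.natCast_dvd_natCast.mpr hpg).trans (Int.gcd_dvd_left (Nβ : ℤ) b)
    exact_mod_cast this
  obtain ⟨v, hv⟩ := hppow
  have hv0 : v ≠ 0 := by
    rintro rfl
    exact hp.one_lt.ne' (Nat.dvd_one.mp (by simpa [hv] using hpN))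
  have ht0 : t ≠ 0 := by
    rintro rfl
    have h1 : (Nβ : ℚ) ≠ 0 := by exact_mod_cast hNβ.1.ne'
    have h2 : (Nγ : ℚ) ≠ 0 := by exact_mod_cast hNγ.1.ne'
    exact mul_ne_zero (mul_ne_zero (mul_ne_zero two_ne_zero h1) h2) hn0 (by simpa using ht.symm)
  obtain ⟨K, h, hpK, hNK, hMK, hph, hK⟩ := exists_scaling hp hNγ.1.ne' hv hv0 ht0 ht hα
  have hc : 0 < p ^ α := pow_pos hp.pos α
  have hpQ : (p : ℚ) ≠ 0 := by exact_mod_cast hp.ne_zero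
  have hpC : (p : ℂ) ≠ 0 := by exact_mod_cast hp.ne_zero
  unfold Gsum
  refine Finset.sum_eq_zero fun ν _ => mul_eq_zero_of_right _ ?_
  refine (mul_eq_zero.mp (?_ : (p : ℂ) * _ = 0)).resolve_left hpC
  rw [← nsmul_eq_mul, ← Finset.card_range p, ← Finset.sum_const, Finset.card_range]
  have key : ∀ s ∈ range p, _ = _ := fun s _ => by
    have hD : K ∣ 2 * K * s := ⟨2 * s, by ring⟩
    have hw : (1 + 2 * K * s).Coprime (p ^ α) := by
      refine Nat.Coprime.pow_right _ ((Nat.Prime.coprime_iff_not_dvd hp).mpr fun hdvd => ?_).symm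
      exact hp.one_lt.ne' (Nat.dvd_one.mp ((Nat.dvd_add_left (hpK.trans hD)).mp hdvd))
    obtain ⟨g, hg⟩ := exists_sub_one_mul_eq hNγ.2.1 (hMK.trans hD) rfl
    obtain ⟨k, hk⟩ := exists_sub_one_mul_eq hNβ.2.1 (hNK.trans hD) rfl
    exact sum_phase_eq_sum_phase_mul hSsymm hSeven hγ hn hβ hβiso hc hw hg hk ν
  rw [Finset.sum_congr rfl key, Finset.sum_comm]
  refine Finset.sum_eq_zero fun d hd => ?_
  rw [Finset.sum_comm]
  refine Finset.sum_eq_zero fun r _ => ?_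
  rw [← Finset.mul_sum]
  refine mul_eq_zero_of_right _ ?_
  have hdp : d.Coprime p :=
    Nat.Coprime.coprime_dvd_right (dvd_pow_self p (by lia)) (mem_filter.mp hd).2
  have hphd : ¬ (p : ℤ) ∣ h * d := fun hdvd =>
    hph ((Nat.isCoprime_iff_coprime.mpr hdp.symm).dvd_of_dvd_mul_right hdvd)
  rw [← sum_eQ_mul_div_eq_zero hp.ne_zero hphd]
  refine Finset.sum_congr rfl fun s _ => ?_
  obtain ⟨K', rfl⟩ := hpK
  rw [← mul_one (eQ ((s : ℚ) * _)), ← eQ_intCast (K' * s ^ 2 * h * d), ← eQ_add]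
  congr 1
  have hpα : (p : ℚ) ^ α ≠ 0 := pow_ne_zero _ hpQ
  push_cast at hK ⊢
  field_simp
  linear_combination (s : ℚ) * (1 + p * K' * s) * d * hK


end EisensteinWeil
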